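/- arXiv:math/0403184 — 2 statements merged into one kernel-verified Lean document; each statement's English description precedes it below -/
import Mathlib

section
/- Let n, p ∈ ℕ with p ≥ 2 and n > 2p, and let b₁, …, b_{n-p} be distinct strictly positive real numbers. Then there exists ε > 0 such that for all a₂, …, a_p ∈ (0, ε), the *-algebra generated by the n×n matrix A = Σ_{k=1}^{n-p} b_k e_{k,k+p} + Σ_{k=2}^{p} a_k e_{1,p+k} is all of M_n(ℂ). -/
open Matrix in
theorem aux_poly {n : ℕ} (T E : Matrix (Fin n) (Fin n) ℂ) (c : ℂ) (hE : E * E = E)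
    (h1 : T * E = c • E) (h2 : E * T = c • E) :
    Polynomial.aeval T (T - c • E).charpoly = ((T - c • E).charpoly.eval c) • E := by
  set T' := T - c • E with hT'
  have key1 : ∀ q : Polynomial ℂ, Polynomial.aeval T q * E = (q.eval c) • E := by
    intro q
    induction q using Polynomial.induction_on' with
    | add f g hf hg => simp [add_mul, hf, hg, add_smul]
    | monomial k r =>
      have : ∀ k : ℕ, T ^ k * E = c ^ k • E := by
        intro k
        induction k with
        | zero => simp
        | succ k ih => rw [pow_succ, mul_assoc, h1, mul_smul_comm, ih, smul_smul, pow_succ, mul_comm]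
      rw [Polynomial.aeval_monomial, mul_assoc, this, Polynomial.eval_monomial,
        Algebra.algebraMap_eq_smul_one, smul_mul_assoc, one_mul, smul_smul]
  have e1 : T * (1 - E) = (1 - E) * T' := by
    simp only [hT', mul_sub, sub_mul, mul_one, one_mul, h1, h2, mul_smul_comm, hE,
      sub_self, smul_zero, sub_zero]
  have e2 : T' * (1 - E) = (1 - E) * T' := by
    simp only [hT', mul_sub, sub_mul, mul_one, one_mul, h1, h2, mul_smul_comm, smul_mul_assoc, hE,
      sub_self, smul_zero, sub_zero]
  have key2 : ∀ q : Polynomial ℂ, Polynomial.aeval T q * (1 - E) = Polynomial.aeval T' q * (1 - E) := by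
    intro q
    induction q using Polynomial.induction_on' with
    | add f g hf hg => rw [map_add, map_add, add_mul, add_mul, hf, hg]
    | monomial k r =>
      have : ∀ k : ℕ, T ^ k * (1 - E) = T' ^ k * (1 - E) := by
        intro k
        induction k with
        | zero => simp
        | succ k ih => rw [pow_succ, mul_assoc, e1, ← mul_assoc, ih, mul_assoc, ← e2, ← mul_assoc,
            ← pow_succ]
      rw [Polynomial.aeval_monomial, mul_assoc, this, Polynomial.aeval_monomial, mul_assoc]
  have h := key2 T'.charpoly
  rw [Matrix.aeval_self_charpoly, zero_mul, mul_sub, mul_one, sub_eq_zero] at h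
  rw [h, key1]

theorem aux_aeval_mem {n : ℕ} (S : StarSubalgebra ℂ (Matrix (Fin n) (Fin n) ℂ))
    {T : Matrix (Fin n) (Fin n) ℂ} (hT : T ∈ S) (q : Polynomial ℂ) :
    Polynomial.aeval T q ∈ S :=
  (Algebra.adjoin_le (S := S.toSubalgebra) (Set.singleton_subset_iff.mpr hT))
    (Polynomial.aeval_mem_adjoin_singleton ℂ T)

theorem aux_smul {n : ℕ} (S : StarSubalgebra ℂ (Matrix (Fin n) (Fin n) ℂ))
    {T : Matrix (Fin n) (Fin n) ℂ} {c : ℂ} (hc : c ≠ 0) (hT : c • T ∈ S) : T ∈ S := by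
  have := S.smul_mem hT c⁻¹
  rwa [smul_smul, inv_mul_cancel₀ hc, one_smul] at this

open Matrix in
theorem aux_diag {n : ℕ} (S : StarSubalgebra ℂ (Matrix (Fin n) (Fin n) ℂ))
    (d : Fin n → ℂ) (hd : Matrix.diagonal d ∈ S) (k : Fin n) (hk : ∀ j, d j = d k → j = k) :
    Matrix.single k k (1:ℂ) ∈ S := by
  classical
  set q : Polynomial ℂ := ∏ j ∈ Finset.univ.erase k, (Polynomial.X - Polynomial.C (d j)) with hq
  have h := aux_aeval_mem S hd q
  have h2 : Polynomial.aeval (Matrix.diagonal d) q = Matrix.diagonal (fun j => q.eval (d j)) := by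
    have := Polynomial.aeval_algHom_apply (Matrix.diagonalAlgHom (n := Fin n) ℂ) d q
    have h3 : (Matrix.diagonalAlgHom (n := Fin n) (α := ℂ) ℂ) d = Matrix.diagonal d := rfl
    rw [h3] at this
    rw [this]
    change Matrix.diagonal _ = _
    congr 1
    ext j
    rw [Polynomial.aeval_pi_apply]
    simp [Polynomial.aeval_def]
  have h4 : Matrix.diagonal (fun j => q.eval (d j)) = q.eval (d k) • Matrix.single k k (1:ℂ) := by
    rw [← Matrix.diagonal_single, ← Matrix.diagonal_smul]
    congr 1
    ext j
    by_cases hj : j = k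
    · subst hj; simp
    · have : q.eval (d j) = 0 := by
        rw [hq, Polynomial.eval_prod]
        apply Finset.prod_eq_zero (i := j) (by simp [hj])
        simp
      simp [this, hj]
  rw [h2, h4] at h
  refine aux_smul S ?_ h
  rw [hq, Polynomial.eval_prod, Finset.prod_ne_zero_iff]
  intro j hj
  simp only [Finset.mem_erase] at hj
  simp only [Polynomial.eval_sub, Polynomial.eval_X, Polynomial.eval_C, sub_ne_zero]
  exact fun h => hj.1 (hk j h.symm)

theorem aux_symm {n : ℕ} (S : StarSubalgebra ℂ (Matrix (Fin n) (Fin n) ℂ)) {i j : Fin n}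
    (h : Matrix.single i j (1:ℂ) ∈ S) : Matrix.single j i (1:ℂ) ∈ S := by
  have := star_mem h
  rwa [Matrix.star_eq_conjTranspose, Matrix.conjTranspose_single, star_one] at this

theorem aux_trans {n : ℕ} (S : StarSubalgebra ℂ (Matrix (Fin n) (Fin n) ℂ)) {i j k : Fin n}
    (h : Matrix.single i j (1:ℂ) ∈ S) (h' : Matrix.single j k (1:ℂ) ∈ S) :
    Matrix.single i k (1:ℂ) ∈ S := by
  have := mul_mem h h'
  rwa [Matrix.single_mul_single_same, mul_one] at this

theorem aux_entry {n : ℕ} (S : StarSubalgebra ℂ (Matrix (Fin n) (Fin n) ℂ)) {i j : Fin n}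
    (h : Matrix.single i i (1:ℂ) ∈ S) (h' : Matrix.single j j (1:ℂ) ∈ S)
    {M : Matrix (Fin n) (Fin n) ℂ} (hM : M ∈ S) (hij : M i j ≠ 0) :
    Matrix.single i j (1:ℂ) ∈ S := by
  have := mul_mem (mul_mem h hM) h'
  refine aux_smul S hij ?_
  convert this using 1
  ext x y
  by_cases hx : i = x <;> by_cases hy : j = y <;>
    simp [Matrix.single_apply, hx, hy, Matrix.mul_apply, ite_and]

theorem aux_top {n : ℕ} (S : StarSubalgebra ℂ (Matrix (Fin n) (Fin n) ℂ))
    (h : ∀ i j, Matrix.single i j (1:ℂ) ∈ S) : S = ⊤ := by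
  rw [eq_top_iff]
  intro M _
  rw [Matrix.matrix_eq_sum_single M]
  refine sum_mem fun i _ => sum_mem fun j _ => ?_
  have := S.smul_mem (h i j) (M i j)
  simpa [Matrix.smul_single] using this

/-- the matrix of the statement, with the first row given by a vector -/
def auxA (n p : ℕ) (b : ℕ → ℝ) (α : Fin n → ℝ) : Matrix (Fin n) (Fin n) ℂ :=
  Matrix.of fun i j => if (j : ℕ) = (i : ℕ) + p then (b (i : ℕ) : ℂ)
    else if (i : ℕ) = 0 then (α j : ℂ) else 0

open Matrix in
theorem aux_cont (n p : ℕ) (b : ℕ → ℝ) : Continuous (auxA n p b) := by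
  refine continuous_matrix fun i j => ?_
  simp only [auxA, Matrix.of_apply]
  split_ifs
  · exact continuous_const
  · exact Complex.continuous_ofReal.comp (continuous_apply j)
  · exact continuous_const

open Matrix in
theorem aux_eps (n p : ℕ) (hn : 2 * p < n)
    (b : ℕ → ℝ) (hbpos : ∀ k < n - p, 0 < b k)
    (hbinj : ∀ k < n - p, ∀ l < n - p, b k = b l → k = l) (P : Fin n) (hP : (P : ℕ) = p) :
    ∃ ε > (0:ℝ), ∀ α : Fin n → ℝ, (∀ j, |α j| < ε) →
      (auxA n p b α * (auxA n p b α)ᴴ - ((b p : ℂ) ^ 2) • Matrix.single P P (1:ℂ)).charpoly.eval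
        ((b p : ℂ) ^ 2) ≠ 0 := by
  have hc : Continuous fun α : Fin n → ℝ =>
      (Matrix.scalar (Fin n) ((b p : ℂ) ^ 2) -
      (auxA n p b α * (auxA n p b α)ᴴ - ((b p : ℂ) ^ 2) • Matrix.single P P (1:ℂ))).det := by
    apply Continuous.matrix_det
    have := aux_cont n p b
    exact continuous_const.sub (((this.matrix_mul this.matrix_conjTranspose)).sub continuous_const)
  have h0 : (auxA n p b 0 * (auxA n p b 0)ᴴ - ((b p : ℂ) ^ 2) • Matrix.single P P (1:ℂ))
      = Matrix.diagonal fun i : Fin n => if (i : ℕ) + p < n ∧ i ≠ P then ((b i : ℂ) ^ 2) else 0 := by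
    ext i j
    simp only [auxA, Matrix.sub_apply, Matrix.mul_apply, Matrix.conjTranspose_apply, Matrix.of_apply,
      Matrix.diagonal_apply, Matrix.smul_apply, Matrix.single_apply, Pi.zero_apply, Complex.ofReal_zero,
      ite_self]
    by_cases hi : (i : ℕ) + p < n
    · rw [Finset.sum_eq_single ⟨(i : ℕ) + p, hi⟩]
      · by_cases hij : i = j
        · subst hij
          by_cases hiP : i = P
          · subst hiP; simp [hP, pow_two]
          · simp [hi, hiP, Ne.symm hiP, pow_two]
        · have : (i : ℕ) ≠ j := fun h => hij (Fin.ext h)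
          have h3 : ¬ (P = i ∧ P = j) := fun h => hij (h.1.symm.trans h.2)
          simp [hij, this, h3]
      · intro x _ hx
        rw [if_neg, zero_mul]
        intro h
        exact hx (Fin.ext h)
      · simp
    · rw [Finset.sum_eq_zero]
      · have : ¬ (P = i ∧ P = j) := by
          rintro ⟨h, -⟩
          subst h; omega
        simp [hi, this]
      · intro x _
        rw [if_neg, zero_mul]
        have := x.2
        omega
  have h1 : (Matrix.scalar (Fin n) ((b p : ℂ) ^ 2) -
      (auxA n p b 0 * (auxA n p b 0)ᴴ - ((b p : ℂ) ^ 2) • Matrix.single P P (1:ℂ))).det ≠ 0 := by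
    rw [h0, Matrix.scalar_apply, Matrix.diagonal_sub, Matrix.det_diagonal, Finset.prod_ne_zero_iff]
    intro i _
    have hbp := hbpos p (by omega)
    split_ifs with h
    · have hbi := hbpos i (by omega)
      have : b p ^ 2 - b i ^ 2 ≠ 0 := by
        intro h'
        have : b i = b p := by nlinarith
        exact h.2 (Fin.ext ((hbinj i (by omega) p (by omega) this).trans hP.symm))
      exact_mod_cast this
    · have : b p ^ 2 - 0 ≠ 0 := by rw [sub_zero]; positivity
      exact_mod_cast this
  have h2 := hc.continuousAt.eventually_ne h1
  rw [Metric.eventually_nhds_iff] at h2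
  obtain ⟨ε, hε, h⟩ := h2
  refine ⟨ε, hε, fun α hα => ?_⟩
  rw [Matrix.eval_charpoly]
  apply h
  rw [dist_pi_lt_iff hε]
  intro j
  simpa [Real.dist_eq] using hα j

open Matrix in
theorem aux_main (n p : ℕ) (hp : 2 ≤ p) (hn : 2 * p < n)
    (b : ℕ → ℝ) (hbpos : ∀ k < n - p, 0 < b k)
    (hbinj : ∀ k < n - p, ∀ l < n - p, b k = b l → k = l)
    (α : Fin n → ℝ) (hα : ∀ j : Fin n, p + 1 ≤ (j : ℕ) → (j : ℕ) ≤ 2 * p - 1 → α j ≠ 0)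
    (hα' : ∀ j : Fin n, (j : ℕ) = 2 * p → α j = 0) (P : Fin n) (hP : (P : ℕ) = p)
    (hev : (auxA n p b α * (auxA n p b α)ᴴ
      - ((b p : ℂ) ^ 2) • Matrix.single P P (1:ℂ)).charpoly.eval ((b p : ℂ) ^ 2) ≠ 0)
    (S : StarSubalgebra ℂ (Matrix (Fin n) (Fin n) ℂ)) (hA : auxA n p b α ∈ S) : S = ⊤ := by
  set A := auxA n p b α with hAdef
  have hAH : Aᴴ ∈ S := star_mem hA
  have hb0 : ∀ k < n - p, (b k : ℂ) ≠ 0 := fun k hk => by exact_mod_cast (hbpos k hk).ne'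
  -- e_pp
  have hT1 : A * Aᴴ * Matrix.single P P (1:ℂ) = ((b p : ℂ) ^ 2) • Matrix.single P P (1:ℂ) := by
    have hEA : Matrix.single P P (1:ℂ) * A = (b p : ℂ) • Matrix.single P ⟨2 * p, hn⟩ (1:ℂ) := by
      ext i j
      by_cases hi : i = P
      · subst hi
        simp only [Matrix.single_mul_apply_same, one_mul, Matrix.smul_apply, Matrix.single_apply,
          hAdef, auxA, Matrix.of_apply]
        by_cases hj : (j : ℕ) = 2 * p
        · have : j = ⟨2 * p, hn⟩ := Fin.ext hj
          subst this
          simp [hP, two_mul]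
        · have h1 : ¬ ((⟨2 * p, hn⟩ : Fin n) = j) := fun h => hj (by rw [← h])
          have h2 : ¬ ((j : ℕ) = (i : ℕ) + p) := by omega
          have h3 : ¬ ((i : ℕ) = 0) := by omega
          simp only [h1, h2, h3, if_false, and_false, smul_zero]
      · simp [Matrix.single_mul_apply_of_ne, hi, Ne.symm hi, Matrix.single_apply]
    have hE2 : Aᴴ * Matrix.single P P (1:ℂ) = (b p : ℂ) • Matrix.single ⟨2 * p, hn⟩ P (1:ℂ) := by
      have := congrArg Matrix.conjTranspose hEA
      simpa [Matrix.conjTranspose_mul, Matrix.conjTranspose_smul, Matrix.conjTranspose_single] using this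
    rw [mul_assoc, hE2, mul_smul_comm, pow_two, mul_smul]
    congr 1
    ext i j
    by_cases hj : j = P
    · subst hj
      simp only [Matrix.mul_single_apply_same, mul_one, Matrix.smul_apply, Matrix.single_apply,
        hAdef, auxA, Matrix.of_apply]
      by_cases hi : i = j
      · subst hi
        simp [hP, two_mul]
      · have h1 : ¬ ((i : ℕ) = (j : ℕ)) := fun h => hi (Fin.ext h)
        have h2 : ¬ (2 * p = (i : ℕ) + p) := by omega
        simp [h2, Ne.symm hi, hα' ⟨2 * p, hn⟩ rfl]
    · simp [Matrix.mul_single_apply_of_ne, hj, Ne.symm hj, Matrix.single_apply]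
  have hT2 : Matrix.single P P (1:ℂ) * (A * Aᴴ) = ((b p : ℂ) ^ 2) • Matrix.single P P (1:ℂ) := by
    have := congrArg Matrix.conjTranspose hT1
    simpa [Matrix.conjTranspose_mul, Matrix.conjTranspose_smul, Matrix.conjTranspose_single,
      mul_assoc] using this
  have hPP : Matrix.single P P (1:ℂ) ∈ S := by
    have h := aux_poly (A * Aᴴ) (Matrix.single P P (1:ℂ)) ((b p : ℂ) ^ 2) (by simp) hT1 hT2
    have h2 := aux_aeval_mem S (mul_mem hA hAH)
      (A * Aᴴ - ((b p : ℂ) ^ 2) • Matrix.single P P (1:ℂ)).charpoly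
    rw [h] at h2
    exact aux_smul S hev h2
  set Z : Fin n := ⟨0, by omega⟩ with hZ
  have hZP : Matrix.single Z P (1:ℂ) ∈ S := by
    have h := mul_mem hA hPP
    refine aux_smul S (hb0 0 (by omega)) ?_
    convert h using 1
    ext i j
    by_cases hj : j = P
    · subst hj
      simp only [Matrix.mul_single_apply_same, mul_one, Matrix.smul_apply, Matrix.single_apply,
        hAdef, auxA, Matrix.of_apply]
      by_cases hi : i = Z
      · subst hi
        simp [hP, hZ]
      · have h1 : ¬ ((i : ℕ) = 0) := fun h => hi (Fin.ext h)
        have h2 : ¬ ((j : ℕ) = (i : ℕ) + p) := by omega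
        simp [h2, h1, Ne.symm hi]
    · simp [Matrix.mul_single_apply_of_ne, hj, Ne.symm hj, Matrix.single_apply]
  have hZZ : Matrix.single Z Z (1:ℂ) ∈ S := aux_trans S hZP (aux_symm S hZP)
  set B := A - Matrix.single Z Z (1:ℂ) * A with hB
  have hBS : B ∈ S := sub_mem hA (mul_mem hZZ hA)
  have hBe : ∀ i j : Fin n, B i j = if (i : ℕ) ≠ 0 ∧ (j : ℕ) = (i : ℕ) + p then (b i : ℂ) else 0 := by
    intro i j
    by_cases hi : i = Z
    · have : (i : ℕ) = 0 := by rw [hi]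
      subst hi
      simp [hB, this]
    · have h1 : ¬ ((i : ℕ) = 0) := fun h => hi (Fin.ext h)
      simp [hB, Matrix.single_mul_apply_of_ne, hi, h1, hAdef, auxA]
  have hBB : B * Bᴴ = Matrix.diagonal
      fun i : Fin n => if (i : ℕ) ≠ 0 ∧ (i : ℕ) + p < n then (b i : ℂ) ^ 2 else 0 := by
    ext i j
    simp only [Matrix.mul_apply, Matrix.conjTranspose_apply, hBe, Matrix.diagonal_apply]
    by_cases hi : (i : ℕ) ≠ 0 ∧ (i : ℕ) + p < n
    · rw [Finset.sum_eq_single ⟨(i : ℕ) + p, hi.2⟩]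
      · by_cases hij : i = j
        · subst hij
          simp [hi, pow_two]
        · have : (i : ℕ) ≠ j := fun h => hij (Fin.ext h)
          simp [hij, this]
      · intro x _ hx
        rw [if_neg, zero_mul]
        intro h
        exact hx (Fin.ext h.2)
      · simp
    · rw [Finset.sum_eq_zero]
      · simp [hi]
      · intro x _
        rw [if_neg, zero_mul]
        have := x.2
        omega
  have hkk : ∀ k : Fin n, (k : ℕ) < n - p → Matrix.single k k (1:ℂ) ∈ S := by
    intro k hk
    by_cases hk0 : (k : ℕ) = 0
    · have : k = Z := Fin.ext hk0
      rw [this]; exact hZZ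
    · have h : B * Bᴴ ∈ S := mul_mem hBS (star_mem hBS)
      rw [hBB] at h
      refine aux_diag S _ h k ?_
      intro j hj
      have hk' : (k : ℕ) ≠ 0 ∧ (k : ℕ) + p < n := ⟨hk0, by omega⟩
      simp only [if_pos hk'] at hj
      have hbk := hbpos k hk
      split_ifs at hj with h2
      · have hbj := hbpos j (by omega)
        have hj' : b j ^ 2 = b k ^ 2 := by exact_mod_cast hj
        have : b j = b k := by nlinarith
        exact Fin.ext (hbinj j (by omega) k hk this)
      · exact absurd hj.symm (pow_ne_zero 2 (hb0 k hk))
  have hstep : ∀ k l : Fin n, (l : ℕ) = (k : ℕ) + p → Matrix.single k l (1:ℂ) ∈ S := by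
    intro k l hkl
    by_cases hk0 : (k : ℕ) = 0
    · have h1 : k = Z := Fin.ext hk0
      have h2 : l = P := Fin.ext (by omega)
      rw [h1, h2]; exact hZP
    · have hk : (k : ℕ) < n - p := by omega
      refine aux_smul S (hb0 k hk) ?_
      convert mul_mem (hkk k hk) hBS using 1
      ext i j
      by_cases hi : i = k
      · subst hi
        simp only [Matrix.single_mul_apply_same, one_mul, Matrix.smul_apply, Matrix.single_apply, hBe]
        by_cases hj : l = j
        · subst hj; simp [hkl, hk0]
        · have : ¬ ((j : ℕ) = (i : ℕ) + p) := fun h => hj (Fin.ext (hkl.trans h.symm))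
          simp [hj, this]
      · simp [Matrix.single_mul_apply_of_ne, hi, Ne.symm hi, Matrix.single_apply]
  have hdiag : ∀ i : Fin n, Matrix.single i i (1:ℂ) ∈ S := by
    intro i
    by_cases hi : (i : ℕ) < n - p
    · exact hkk i hi
    · have h := hstep ⟨(i : ℕ) - p, by omega⟩ i (by simp only; omega)
      exact aux_trans S (aux_symm S h) h
  have hconn : ∀ m : ℕ, ∀ hm : m < n, Matrix.single Z ⟨m, hm⟩ (1:ℂ) ∈ S := by
    intro m
    induction m using Nat.strong_induction_on with
    | _ m ih =>
      intro hm
      by_cases hmp : p ≤ m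
      · exact aux_trans S (ih (m - p) (by omega) (by omega))
          (hstep ⟨m - p, by omega⟩ ⟨m, hm⟩ (by simp only; omega))
      · by_cases hm0 : m = 0
        · subst hm0; exact hZZ
        · have h1 : Matrix.single Z ⟨m + p, by omega⟩ (1:ℂ) ∈ S := by
            refine aux_entry S (hdiag _) (hdiag _) hA ?_
            have h := hα ⟨m + p, by omega⟩ (by simp only; omega) (by simp only; omega)
            simp [hAdef, auxA, hZ, hm0, h]
          exact aux_trans S h1 (aux_symm S (hstep ⟨m, hm⟩ ⟨m + p, by omega⟩ rfl))
  exact aux_top S fun i j => aux_trans S (aux_symm S (hconn i i.2)) (hconn j j.2)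

/-- Lemma 2.6: for `p ≥ 2`, `n > 2p` and distinct strictly positive `b₁,…,b_{n−p}`, there
is `ε > 0` such that for any `a₂,…,a_p ∈ (0,ε)`, the matrix
`A = Σ_{k=1}^{n−p} b_k e_{k,k+p} + Σ_{k=2}^{p} a_k e_{1,p+k}` generates `M_n(ℂ)` as a
*-algebra.  (Indices are written `0`-based: `b` is indexed by `0,…,n−p−1`.) -/
theorem stmt4 (n p : ℕ) (hp : 2 ≤ p) (hn : 2 * p < n)
    (b : ℕ → ℝ) (hbpos : ∀ k < n - p, 0 < b k)
    (hbinj : ∀ k < n - p, ∀ l < n - p, b k = b l → k = l) :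
    ∃ ε > (0:ℝ), ∀ a : ℕ → ℝ, (∀ k, 2 ≤ k → k ≤ p → a k ∈ Set.Ioo 0 ε) →
      StarAlgebra.adjoin ℂ
        ({Matrix.of fun i j : Fin n =>
          if (j : ℕ) = (i : ℕ) + p then (b (i : ℕ) : ℂ)
          else if (i : ℕ) = 0 ∧ p + 1 ≤ (j : ℕ) ∧ (j : ℕ) ≤ 2 * p - 1 then
            (a ((j : ℕ) - p + 1) : ℂ)
          else 0} : Set (Matrix (Fin n) (Fin n) ℂ)) = ⊤ := by
  obtain ⟨ε, hε, h⟩ := aux_eps n p hn b hbpos hbinj ⟨p, by omega⟩ rfl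
  refine ⟨ε, hε, fun a ha => ?_⟩
  set α : Fin n → ℝ := fun j =>
    if p + 1 ≤ (j : ℕ) ∧ (j : ℕ) ≤ 2 * p - 1 then a ((j : ℕ) - p + 1) else 0 with hαdef
  have hα : ∀ j : Fin n, p + 1 ≤ (j : ℕ) → (j : ℕ) ≤ 2 * p - 1 →
      α j ∈ Set.Ioo 0 ε := by
    intro j h1 h2
    simp only [hαdef, h1, h2, and_self, if_true]
    exact ha _ (by omega) (by omega)
  refine aux_main n p hp hn b hbpos hbinj α (fun j h1 h2 => (hα j h1 h2).1.ne') ?_ ⟨p, by omega⟩ rfl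
    (h α ?_) _ ?_
  · intro j hj
    have : ¬ (p + 1 ≤ (j : ℕ) ∧ (j : ℕ) ≤ 2 * p - 1) := by omega
    simp only [hαdef, if_neg this]
  · intro j
    by_cases hj : p + 1 ≤ (j : ℕ) ∧ (j : ℕ) ≤ 2 * p - 1
    · have := hα j hj.1 hj.2
      rw [abs_of_pos this.1]
      exact this.2
    · simp only [hαdef, if_neg hj, abs_zero]
      exact hε
  · apply StarAlgebra.subset_adjoin
    rw [Set.mem_singleton_iff]
    ext i j
    simp only [auxA, Matrix.of_apply, hαdef]
    by_cases h1 : (j : ℕ) = (i : ℕ) + p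
    · simp only [if_pos h1]
    · simp only [if_neg h1]
      by_cases h2 : (i : ℕ) = 0
      · simp only [h2, true_and, if_true]
        split_ifs <;> simp
      · simp [h2]
end

section
/- Let (M, τ) be a von Neumann algebra with a normal faithful tracial state, let a ∈ M and q a projection in M with τ(q) > 0, and let 0 < θ < τ(q). Then s_θ(a; τ) ≥ s_{θ/τ(q)}(qaq; τ(q)⁻¹ τ restricted to qMq), where s_t(x; τ) = inf{ ‖x(1−p)‖ : p a projection in the algebra, τ(p) ≤ t } is the t-th singular number. -/
open scoped ComplexOrder

/-- The `t`-th singular number of `a` relative to a set `P` of projections with unit `e`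
and trace `τ`:  `inf {‖a(e−p)‖ : p ∈ P, τ(p) ≤ t}`. -/
noncomputable def sNumIn {H : Type*} [NormedAddCommGroup H] [InnerProductSpace ℂ H]
    [CompleteSpace H] (P : Set (H →L[ℂ] H)) (e : H →L[ℂ] H)
    (τ : (H →L[ℂ] H) → ℝ) (t : ℝ) (a : H →L[ℂ] H) : ℝ :=
  sInf {r : ℝ | ∃ p ∈ P, τ p ≤ t ∧ r = ‖a * (e - p)‖}

/-- Construction of the partial isometry `u` with `u b = x`, vanishing on `ker b`. -/
lemma polar_exists {H : Type*} [NormedAddCommGroup H] [InnerProductSpace ℂ H]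
    [CompleteSpace H] (x b : H →L[ℂ] H) (hb : IsSelfAdjoint b)
    (hn : ∀ v, ‖x v‖ = ‖b v‖) :
    ∃ u : H →L[ℂ] H, u * b = x ∧ ∀ z, b z = 0 → u z = 0 := by
  set K : Submodule ℂ H := (LinearMap.range b.toLinearMap).topologicalClosure with hK
  have hmem : ∀ v, b v ∈ K := fun v =>
    Submodule.le_topologicalClosure _ ⟨v, rfl⟩
  let e : H →ₗ[ℂ] K := LinearMap.codRestrict K b.toLinearMap hmem
  have hd : DenseRange e := by
    intro y
    rw [closure_subtype]
    have hy : (y : H) ∈ closure (Set.range b) := by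
      exact y.2
    convert hy using 2
    ext w
    constructor
    · rintro ⟨_, ⟨v, rfl⟩, rfl⟩
      exact ⟨v, rfl⟩
    · rintro ⟨v, rfl⟩
      exact ⟨e v, ⟨v, rfl⟩, rfl⟩
  have hC : ∃ C, ∀ v, ‖x.toLinearMap v‖ ≤ C * ‖e v‖ :=
    ⟨1, fun v => by
      rw [one_mul]
      exact (hn v).le⟩
  have : CompleteSpace K := (Submodule.isClosed_topologicalClosure _).completeSpace_coe
  let g : K →L[ℂ] H := x.toLinearMap.extendOfNorm e
  have hg : ∀ v, g (e v) = x v := fun v => LinearMap.extendOfNorm_eq hd hC v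
  refine ⟨g ∘L K.orthogonalProjection, ?_, ?_⟩
  · ext v
    have : K.orthogonalProjection (b v) = e v :=
      Submodule.orthogonalProjection_mem_subspace_eq_self (e v)
    simp [this, hg]
  · intro z hz
    have hzK : z ∈ Kᗮ := by
      rw [hK, Submodule.orthogonal_closure]
      rintro _ ⟨v, rfl⟩
      have := ContinuousLinearMap.adjoint_inner_right b v z
      rw [← ContinuousLinearMap.star_eq_adjoint, hb.star_eq, hz] at this
      simpa using this.symm
    have : K.orthogonalProjection z = 0 :=
      Submodule.orthogonalProjection_mem_subspace_orthogonalComplement_eq_zero hzK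
    simp [this]

/-- Operators agreeing on `ran b` and vanishing on `ker b` coincide. -/
lemma ext_on {H : Type*} [NormedAddCommGroup H] [InnerProductSpace ℂ H]
    [CompleteSpace H] (b c : H →L[ℂ] H) (hb : IsSelfAdjoint b)
    (h : c * b = 0) (hc : ∀ z, b z = 0 → c z = 0) : c = 0 := by
  have h1 : b * star c = 0 := by
    have := congrArg star h
    simpa [hb.star_eq] using this
  have h2 : c * star c = 0 := by
    ext v
    exact hc _ (by simpa using congrArg (fun T : H →L[ℂ] H => T v) h1)
  exact CStarRing.mul_star_self_eq_zero_iff c |>.1 h2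

lemma polar_in {H : Type*} [NormedAddCommGroup H] [InnerProductSpace ℂ H]
    [CompleteSpace H] (M : VonNeumannAlgebra H) (x : H →L[ℂ] H) (hx : x ∈ M) :
    ∃ u ∈ M, u * star u * u = u ∧ x * (star u * u) = x ∧
      (∀ z, x z = 0 → u z = 0) ∧ (∀ p, p * x = x → p * u = u) := by
  obtain ⟨b, hb, hbb, hcomm⟩ : ∃ b : H →L[ℂ] H, IsSelfAdjoint b ∧ b * b = star x * x ∧
      ∀ y, Commute y x → Commute y (star x) → Commute y b :=
    ⟨CFC.abs x, (CFC.abs_nonneg x).isSelfAdjoint, CFC.abs_mul_abs x,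
      fun y h1 h2 => by
        have h3 : Commute x (star y) := by
          have := congrArg star h2.eq
          simp only [star_mul, star_star] at this
          exact this
        exact (h1.symm.cfcAbs_left h3).symm⟩
  have hn : ∀ v, ‖x v‖ = ‖b v‖ := by
    intro v
    have h1 := ContinuousLinearMap.apply_norm_sq_eq_inner_adjoint_left x v
    have h2 := ContinuousLinearMap.apply_norm_sq_eq_inner_adjoint_left b v
    rw [← ContinuousLinearMap.star_eq_adjoint] at h1 h2
    rw [hb.star_eq] at h2
    have h3 : (star x ∘L x) = b ∘L b := hbb.symm
    rw [h3] at h1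
    have : ‖x v‖ ^ 2 = ‖b v‖ ^ 2 := h1.trans h2.symm
    exact (sq_eq_sq₀ (norm_nonneg _) (norm_nonneg _)).1 this
  have hker : ∀ z, x z = 0 ↔ b z = 0 := fun z => by
    rw [← norm_eq_zero, hn, norm_eq_zero]
  obtain ⟨u, hub, huk⟩ := polar_exists x b hb hn
  have hbu : b * star u = star x := by rw [← hub]; simp [hb.star_eq]
  have hd0 : b * (star u * u * b - b) = 0 := by
    rw [mul_sub, mul_assoc (star u), hub, ← mul_assoc, hbu, hbb, sub_self]
  have hd1 : u * (star u * u * b - b) = 0 := by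
    ext v
    exact huk _ (by simpa using congrArg (fun T : H →L[ℂ] H => T v) hd0)
  have hd : star u * u * b = b := by
    rw [← sub_eq_zero, ← CStarRing.star_mul_self_eq_zero_iff]
    have : star (star u * u * b - b) = b * star u * u - b := by
      simp [hb.star_eq, mul_assoc]
    rw [this, sub_mul, mul_assoc (b * star u), hd1, hd0]
    simp
  have hd' : b * (star u * u) = b := by
    have := congrArg star hd
    simpa [hb.star_eq, mul_assoc] using this
  refine ⟨u, ?_, ?_, ?_, ?_, ?_⟩
  · rw [← M.commutant_commutant, VonNeumannAlgebra.mem_commutant_iff]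
    intro y hy
    rw [VonNeumannAlgebra.mem_commutant_iff] at hy
    have h1 : y * x = x * y := (hy x hx).symm
    have h2 : y * star x = star x * y := (hy (star x) (star_mem hx)).symm
    have h3 : y * b = b * y := hcomm y h1 h2
    rw [← sub_eq_zero]
    refine ext_on b _ hb ?_ ?_
    · rw [sub_mul, mul_assoc, hub, mul_assoc, h3, ← mul_assoc, hub, h1, sub_self]
    · intro z hz
      have h4 : b (y z) = 0 := by
        have := congrArg (fun T : H →L[ℂ] H => T z) h3
        simp only [ContinuousLinearMap.mul_apply] at this
        rw [← this, hz, map_zero]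
      simp [huk z hz, huk _ h4]
  · rw [← sub_eq_zero]
    refine ext_on b _ hb ?_ ?_
    · rw [sub_mul, mul_assoc u, mul_assoc u, hd, sub_self]
    · intro z hz
      simp [huk z hz]
  · rw [← hub, mul_assoc, hd']
  · intro z hz
    exact huk z ((hker z).1 hz)
  · intro p hp
    rw [← sub_eq_zero]
    refine ext_on b _ hb ?_ ?_
    · rw [sub_mul, mul_assoc, hub, hp, sub_self]
    · intro z hz
      simp [huk z hz]

lemma norm_proj_le {H : Type*} [NormedAddCommGroup H] [InnerProductSpace ℂ H]
    [CompleteSpace H] (p : H →L[ℂ] H) (h : IsSelfAdjoint p) (h2 : p * p = p) : ‖p‖ ≤ 1 := by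
  have : ‖p‖ * ‖p‖ = ‖p‖ := by
    rw [← CStarRing.norm_star_mul_self, h.star_eq, h2]
  nlinarith [norm_nonneg p]

/-- Lemma 3.2: `s_θ(a; τ) ≥ s_{θ/τ(q)}(qaq; τ(q)⁻¹ τ|_{qMq})` for a projection `q` in a
von Neumann algebra `M` with faithful tracial state `τ` and `0 < θ < τ(q)`. -/
theorem stmt5 {H : Type*} [NormedAddCommGroup H] [InnerProductSpace ℂ H] [CompleteSpace H]
    (M : VonNeumannAlgebra H) (τ : (H →L[ℂ] H) → ℝ)
    (hadd : ∀ x ∈ M, ∀ y ∈ M, τ (x + y) = τ x + τ y)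
    (hpos : ∀ x ∈ M, 0 ≤ τ (star x * x))
    (htr : ∀ x ∈ M, ∀ y ∈ M, τ (x * y) = τ (y * x))
    (hone : τ 1 = 1)
    (hfaith : ∀ x ∈ M, τ (star x * x) = 0 → x = 0)
    (a : H →L[ℂ] H) (ha : a ∈ M)
    (q : H →L[ℂ] H) (hq : q ∈ M) (hqsa : IsSelfAdjoint q) (hqidem : q * q = q)
    (hqτ : 0 < τ q)
    (θ : ℝ) (hθ0 : 0 < θ) (hθq : θ < τ q) :
    sNumIn {p | p ∈ M ∧ IsSelfAdjoint p ∧ p * p = p} 1 τ θ a ≥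
    sNumIn {p | p ∈ M ∧ IsSelfAdjoint p ∧ p * p = p ∧ q * p = p ∧ p * q = p} q
      (fun x => τ x / τ q) (θ / τ q) (q * a * q) := by
  have h0 : τ 0 = 0 := by
    have := hadd 0 (zero_mem M) 0 (zero_mem M)
    rw [add_zero] at this
    linarith
  unfold sNumIn
  refine le_csInf ⟨_, 0, ⟨zero_mem M, IsSelfAdjoint.zero _, by simp⟩, by rw [h0]; exact hθ0.le, rfl⟩ ?_
  rintro r ⟨p, ⟨hp, hpsa, hpp⟩, hpθ, rfl⟩
  obtain ⟨u, hu, huu, hxu, hker, hleft⟩ := polar_in M (p * q) (mul_mem hp hq)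
  have hus : star u ∈ M := star_mem hu
  have hpu : p * u = u := hleft p (by rw [← mul_assoc, hpp])
  have hup : star u * p = star u := by
    have := congrArg star hpu
    simpa [hpsa.star_eq] using this
  have huq : u * q = u := by
    have : u * (1 - q) = 0 := by
      ext v
      refine hker _ ?_
      have h : (p * q) * (1 - q) = 0 := by
        rw [mul_sub, mul_one, mul_assoc, hqidem, sub_self]
      exact congrArg (fun T : H →L[ℂ] H => T v) h
    rw [mul_sub, mul_one, sub_eq_zero] at this
    exact this.symm
  have hqu : q * star u = star u := by
    have := congrArg star huq
    simpa [hqsa.star_eq] using this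
  set f : H →L[ℂ] H := star u * u with hf
  have hfM : f ∈ M := mul_mem hus hu
  have hfsa : IsSelfAdjoint f := IsSelfAdjoint.star_mul_self u
  have hff : f * f = f := by
    rw [hf, mul_assoc, ← mul_assoc u, huu]
  have hqf : q * f = f := by rw [hf, ← mul_assoc, hqu]
  have hfq : f * q = f := by rw [hf, mul_assoc, huq]
  have hτ : τ f ≤ τ p := by
    set d : H →L[ℂ] H := p - u * star u with hd
    have huM : u * star u ∈ M := mul_mem hu hus
    have hdM : d ∈ M := sub_mem hp huM
    have hdd : star d * d = d := by
      have e1 : star d = d := by simp [hd, hpsa.star_eq]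
      have e2 : p * (u * star u) = u * star u := by rw [← mul_assoc, hpu]
      have e3 : u * star u * p = u * star u := by rw [mul_assoc, hup]
      have e4 : u * star u * (u * star u) = u * star u := by rw [← mul_assoc, huu]
      rw [e1, hd, sub_mul, mul_sub, mul_sub, hpp, e2, e3, e4, sub_self, sub_zero]
    have h1 := hpos d hdM
    rw [hdd] at h1
    have h2 := hadd d hdM _ huM
    rw [hd, sub_add_cancel, ← hd] at h2
    rw [htr u hu _ hus] at h2
    linarith
  refine le_trans (csInf_le ⟨0, ?_⟩ (?_ : ‖q * a * q * (q - f)‖ ∈ _)) ?_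
  · rintro _ ⟨_, _, _, rfl⟩
    exact norm_nonneg _
  · exact ⟨f, ⟨hfM, hfsa, hff, hqf, hfq⟩,
      div_le_div_of_nonneg_right (hτ.trans hpθ) hqτ.le, rfl⟩
  · have hq' : q * (q - f) = q - f := by rw [mul_sub, hqidem, hqf]
    have hpf : p * (q - f) = 0 := by
      rw [← hq', ← mul_assoc, mul_sub, hxu, mul_assoc, hqidem, sub_self]
    have e : q * a * q * (q - f) = q * (a * (1 - p)) * (q - f) := by
      rw [mul_assoc (q * a), hq', mul_assoc q (a * (1 - p)), mul_assoc a, sub_mul, hpf, one_mul,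
        sub_zero, mul_assoc]
    rw [e]
    have n1 := norm_proj_le q hqsa hqidem
    have n2 := norm_proj_le (q - f) (hqsa.sub hfsa) (by
      rw [sub_mul, hq', mul_sub, hfq, hff, sub_self, sub_zero])
    calc ‖q * (a * (1 - p)) * (q - f)‖ ≤ ‖q‖ * ‖a * (1 - p)‖ * ‖q - f‖ :=
          (norm_mul_le _ _).trans (by gcongr; exact norm_mul_le _ _)
      _ ≤ 1 * ‖a * (1 - p)‖ * 1 := by gcongr
      _ = ‖a * (1 - p)‖ := by ring
end
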